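/- arXiv:hep-th/0603162 — 2 statements merged into one kernel-verified Lean document; each statement's English description precedes it below -/
import Mathlib

section
/- Let F be a finite field with q elements and let K be an algebraic closure of F. For all integers m ≥ 1 and n ≥ 1, the number of ordered pairs (f, g) where f is a nonzero homogeneous polynomial of degree m in F[x, y], g is a nonzero homogeneous polynomial of degree n in F[x, y], and f and g have no common zero in K² ∖ {(0,0)}, equals q^{m+n−1}·(q − 1)·(q² − 1). -/
open MvPolynomial

namespace CoprimeCount

open Polynomial

/-- Coprime pairs with the first of degree exactly `a`, the second of degree `< B`. -/
def G (F : Type*) [Field F] (a B : ℕ) : Set (F[X] × F[X]) :=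
  {p | p.1.degree = a ∧ p.2.degree < B ∧ IsCoprime p.1 p.2}

variable {F : Type*} [Field F]

theorem ncard_lt [Fintype F] (k : ℕ) :
    {t : F[X] | t.degree < k}.ncard = Fintype.card F ^ k := by
  have h : {t : F[X] | t.degree < k} = (degreeLT F k : Set F[X]) := by
    ext t; simp [mem_degreeLT]
  rw [h, ← Nat.card_coe_set_eq]
  have := Nat.card_congr (degreeLTEquiv F k).toEquiv
  simpa using this

theorem finite_lt [Fintype F] (k : ℕ) : {t : F[X] | t.degree < k}.Finite := by
  apply Set.finite_of_ncard_ne_zero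
  rw [ncard_lt]
  exact pow_ne_zero _ Fintype.card_ne_zero

theorem degree_lt_succ (t : F[X]) (k : ℕ) :
    t.degree < ((k + 1 : ℕ) : WithBot ℕ) ↔ t.degree < k ∨ t.degree = k := by
  rw [← le_iff_lt_or_eq]
  by_cases h : t = 0
  · simp [h, WithBot.bot_lt_coe]
  · rw [degree_eq_natDegree h]; norm_cast; omega

theorem ncard_eq [Fintype F] (k : ℕ) :
    {t : F[X] | t.degree = k}.ncard = (Fintype.card F - 1) * Fintype.card F ^ k := by
  have h : {t : F[X] | t.degree < ((k + 1 : ℕ) : WithBot ℕ)}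
      = {t : F[X] | t.degree < k} ∪ {t : F[X] | t.degree = k} := by
    ext t; exact degree_lt_succ t k
  have hf := finite_lt (F := F) (k + 1)
  have h2 := congrArg Set.ncard h
  rw [h] at hf
  rw [Set.ncard_union_eq _ (hf.subset Set.subset_union_left) (hf.subset Set.subset_union_right),
    ncard_lt, ncard_lt] at h2
  · rw [Nat.sub_mul, one_mul, ← pow_succ']; omega
  · rw [Set.disjoint_left]
    intro t h1 h2
    simp only [Set.mem_ofPred_eq] at h1 h2
    rw [h2] at h1
    exact lt_irrefl _ h1

theorem div_count (a : ℕ) (P Q : F[X] → Prop)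
    (hPQ : ∀ p s t : F[X], p.degree = a → s.degree < a → (Q (s + p * t) ↔ P t)) :
    {p : F[X] × F[X] | p.1.degree = a ∧ Q p.2 ∧ IsCoprime p.1 p.2}.ncard
      = (G F a a).ncard * {t | P t}.ncard := by
  rw [← Set.ncard_prod]
  have himg : {p : F[X] × F[X] | p.1.degree = a ∧ Q p.2 ∧ IsCoprime p.1 p.2} =
      (fun z : (F[X] × F[X]) × F[X] => (z.1.1, z.1.2 + z.1.1 * z.2)) ''
        (G F a a ×ˢ {t | P t}) := by
    ext ⟨p, r⟩
    simp only [Set.mem_ofPred_eq, Set.mem_image, Set.mem_prod, G, Prod.exists, Prod.mk.injEq]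
    constructor
    · rintro ⟨hp, hq, hc⟩
      have hp0 : p ≠ 0 := by rintro rfl; simp at hp
      have hmod : (r % p).degree < a := hp ▸ degree_mod_lt r hp0
      have he : r % p + p * (r / p) = r := EuclideanDomain.mod_add_div r p
      refine ⟨p, r % p, r / p, ⟨⟨hp, hmod, ?_⟩, ?_⟩, rfl, he⟩
      · rw [← he] at hc; exact hc.of_add_mul_left_right
      · rw [← hPQ p (r % p) (r / p) hp hmod, he]; exact hq
    · rintro ⟨p', s, t, ⟨⟨hp, hs, hc⟩, ht⟩, rfl, rfl⟩
      exact ⟨hp, (hPQ _ _ _ hp hs).2 ht, hc.add_mul_left_right t⟩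
  rw [himg]
  apply Set.ncard_image_of_injOn
  rintro ⟨⟨p, s⟩, t⟩ ⟨⟨hp, hs, -⟩, -⟩ ⟨⟨p', s'⟩, t'⟩ ⟨⟨hp', hs', -⟩, -⟩ h
  simp only [Prod.mk.injEq] at h hp hs hp' hs' ⊢
  obtain ⟨rfl, h⟩ := h
  have hp0 : p ≠ 0 := by rintro rfl; simp at hp
  have hd : s - s' = p * (t' - t) := by linear_combination h
  have h0 : s - s' = 0 := by
    apply eq_zero_of_dvd_of_degree_lt (Dvd.intro _ hd.symm)
    rw [hp]
    exact (degree_sub_le _ _).trans_lt (max_lt hs hs')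
  rw [h0] at hd
  have := (mul_eq_zero.1 hd.symm).resolve_left hp0
  exact ⟨⟨rfl, sub_eq_zero.1 h0⟩, (sub_eq_zero.1 this).symm⟩

theorem G_finite [Fintype F] (a B : ℕ) : (G F a B).Finite := by
  apply ((finite_lt (F := F) (a + 1)).prod (finite_lt (F := F) B)).subset
  rintro ⟨p, r⟩ ⟨h1, h2, -⟩
  exact ⟨(degree_lt_succ _ _).2 (Or.inr h1), h2⟩

theorem G_large [Fintype F] (a k : ℕ) :
    (G F a (a + k)).ncard = (G F a a).ncard * Fintype.card F ^ k := by
  rw [← ncard_lt]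
  apply div_count a (fun t => t.degree < k) (fun r => r.degree < ((a + k : ℕ) : WithBot ℕ))
  intro p s t hp hs
  have hs' : s.degree < ((a + k : ℕ) : WithBot ℕ) :=
    hs.trans_le (by exact_mod_cast Nat.le_add_right a k)
  have key : (p * t).degree < ((a + k : ℕ) : WithBot ℕ) ↔ t.degree < k := by
    rw [degree_mul, hp]
    by_cases h : t = 0
    · simp [h, WithBot.bot_lt_coe]
    · rw [degree_eq_natDegree h]; norm_cast; omega
  rw [← key]
  constructor
  · intro h
    have : p * t = (s + p * t) - s := by ring
    rw [this]
    exact (degree_sub_le _ _).trans_lt (max_lt h hs')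
  · intro h
    exact (degree_add_le _ _).trans_lt (max_lt hs' h)

theorem X_count [Fintype F] (j k : ℕ) :
    {p : F[X] × F[X] | p.1.degree = j ∧ p.2.degree = ((j + k : ℕ) : WithBot ℕ) ∧
      IsCoprime p.1 p.2}.ncard
      = (G F j j).ncard * ((Fintype.card F - 1) * Fintype.card F ^ k) := by
  rw [← ncard_eq]
  apply div_count j (fun t => t.degree = k) (fun r => r.degree = ((j + k : ℕ) : WithBot ℕ))
  intro p s t hp hs
  have key : (p * t).degree = ((j + k : ℕ) : WithBot ℕ) ↔ t.degree = k := by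
    rw [degree_mul, hp]
    by_cases h : t = 0
    · rw [h, degree_zero, WithBot.add_bot]
      exact iff_of_false (WithBot.natCast_ne_bot _).symm (WithBot.natCast_ne_bot _).symm
    · rw [degree_eq_natDegree h]; norm_cast; omega
  rw [← key]
  by_cases h : t = 0
  · subst h
    simp only [mul_zero, add_zero, degree_zero]
    constructor
    · intro h
      rw [h] at hs
      norm_cast at hs; omega
    · intro h; exact absurd h.symm (WithBot.natCast_ne_bot _)
  · rw [degree_add_eq_right_of_degree_lt]
    refine hs.trans_le ?_
    rw [degree_mul, hp, degree_eq_natDegree h]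
    norm_cast; omega

theorem G_succ [Fintype F] (j k : ℕ) :
    (G F (j + k) (j + 1)).ncard = (G F (j + k) j).ncard +
      (G F j j).ncard * ((Fintype.card F - 1) * Fintype.card F ^ k) := by
  rw [← X_count, ← Set.ncard_image_of_injective ({p : F[X] × F[X] | p.1.degree = j ∧ p.2.degree = ((j + k : ℕ) : WithBot ℕ) ∧
      IsCoprime p.1 p.2}) Prod.swap_injective]
  have h : G F (j + k) (j + 1) = G F (j + k) j ∪ (Prod.swap ''
      {p : F[X] × F[X] | p.1.degree = j ∧ p.2.degree = ((j + k : ℕ) : WithBot ℕ) ∧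
      IsCoprime p.1 p.2}) := by
    ext ⟨p, r⟩
    simp only [G, Set.mem_ofPred_eq, Set.image_swap_eq_preimage_swap, Set.mem_union,
      Set.mem_preimage, Prod.fst_swap, Prod.snd_swap, degree_lt_succ, isCoprime_comm (x := r)]
    tauto
  have hf := G_finite (F := F) (j + k) (j + 1)
  rw [h] at hf
  rw [h, Set.ncard_union_eq _ (hf.subset Set.subset_union_left) (hf.subset Set.subset_union_right)]
  rw [Set.disjoint_left]
  rintro ⟨p, r⟩ h1 h2
  simp only [G, Set.mem_ofPred_eq, Set.image_swap_eq_preimage_swap,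
      Set.mem_preimage, Prod.fst_swap, Prod.snd_swap] at h1 h2
  rw [h2.1] at h1
  exact lt_irrefl _ h1.2.1

theorem G_zero (a : ℕ) (ha : 1 ≤ a) : (G F a 0).ncard = 0 := by
  have : G F a 0 = ∅ := by
    ext ⟨p, r⟩
    simp only [G, Set.mem_ofPred_eq, Set.mem_empty_iff_false, iff_false]
    rintro ⟨h1, h2, h3⟩
    have : r = 0 := by simpa [Nat.cast_withBot] using h2
    subst this
    rw [isCoprime_zero_right] at h3
    rw [degree_eq_zero_of_isUnit h3] at h1
    norm_cast at h1; omega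
  rw [this, Set.ncard_empty]

theorem G_zero_zero [Fintype F] : (G F 0 0).ncard = Fintype.card F - 1 := by
  have h := ncard_eq (F := F) 0
  rw [pow_zero, mul_one] at h
  rw [← h]
  have : G F 0 0 = (fun p => (p, 0)) '' {t : F[X] | t.degree = (0 : ℕ)} := by
    ext ⟨p, r⟩
    simp only [G, Set.mem_ofPred_eq, Set.mem_image, Prod.mk.injEq]
    constructor
    · rintro ⟨h1, h2, h3⟩
      have : r = 0 := by simpa [Nat.cast_withBot] using h2
      exact ⟨p, h1, rfl, this.symm⟩
    · rintro ⟨_, h, rfl, rfl⟩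
      refine ⟨h, by simp [Nat.cast_withBot, WithBot.bot_lt_coe], ?_⟩
      rw [isCoprime_zero_right, isUnit_iff_degree_eq_zero]
      exact_mod_cast h
  rw [this, Set.ncard_image_of_injective]
  intro x y h
  simpa using h

theorem G_small [Fintype F] (b k : ℕ) :
    (G F (b + 1 + k) (b + 1)).ncard
      = (Fintype.card F - 1) ^ 2 * Fintype.card F ^ (2 * b + 1 + k) := by
  induction b generalizing k with
  | zero =>
    have h := G_succ (F := F) 0 (1 + k)
    rw [G_zero _ (by omega), G_zero_zero] at h
    simp only [zero_add] at h ⊢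
    rw [h]; ring
  | succ b ih =>
    have h := G_succ (F := F) (b + 1) (1 + k)
    have h0 := ih 0
    have h1 := ih (1 + k)
    rw [h1] at h
    simp only [add_zero] at h0
    rw [h0] at h
    rw [show b + 1 + 1 + k = b + 1 + (1 + k) by ring, h]
    obtain ⟨q, hq⟩ : ∃ q, Fintype.card F = q + 1 :=
      ⟨_, (Nat.succ_pred_eq_of_pos Fintype.card_pos).symm⟩
    rw [hq]
    simp only [Nat.add_sub_cancel]
    ring

theorem G_card [Fintype F] (a B : ℕ) (ha : 1 ≤ a) (hB : 1 ≤ B) :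
    (G F a B).ncard = (Fintype.card F - 1) ^ 2 * Fintype.card F ^ (a + B - 1) := by
  obtain ⟨b, rfl⟩ : ∃ b, B = b + 1 := ⟨B - 1, by omega⟩
  rcases le_total (b + 1) a with h | h
  · obtain ⟨k, rfl⟩ := Nat.exists_eq_add_of_le h
    rw [G_small]; congr 2; omega
  · obtain ⟨k, hk⟩ := Nat.exists_eq_add_of_le h
    obtain ⟨c, rfl⟩ : ∃ c, a = c + 1 := ⟨a - 1, by omega⟩
    have h0 := G_small (F := F) c 0
    simp only [add_zero] at h0
    rw [hk, G_large, h0, mul_assoc, ← pow_add]; congr 2; omega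

/-- The dehomogenized set of pairs. -/
def S (F : Type*) [Field F] (m n : ℕ) : Set (F[X] × F[X]) :=
  {p | p.1.natDegree ≤ m ∧ p.2.natDegree ≤ n ∧ IsCoprime p.1 p.2 ∧
    ¬ (p.1.coeff m = 0 ∧ p.2.coeff n = 0)}

theorem natDegree_le_lt (p : F[X]) (m : ℕ) : p.natDegree ≤ m ↔ p.degree < m ∨ p.degree = m := by
  rw [← le_iff_lt_or_eq, natDegree_le_iff_degree_le]

theorem S_card [Fintype F] (m n : ℕ) (hm : 1 ≤ m) (hn : 1 ≤ n) :
    (S F m n).ncard = Fintype.card F ^ (m + n - 1) * (Fintype.card F - 1)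
      * (Fintype.card F ^ 2 - 1) := by
  have hc : ∀ (p : F[X]) (k : ℕ), p.natDegree ≤ k → (p.coeff k = 0 ↔ p.degree < k) := by
    intro p k h
    constructor
    · intro h0
      rcases (natDegree_le_lt p k).1 h with h1 | h1
      · exact h1
      · exact absurd h0 (coeff_ne_zero_of_eq_degree h1)
    · exact coeff_eq_zero_of_degree_lt
  have h : S F m n = G F m (n + 1) ∪ Prod.swap '' G F n m := by
    ext ⟨p, r⟩
    simp only [S, G, Set.mem_ofPred_eq, Set.image_swap_eq_preimage_swap, Set.mem_union,
      Set.mem_preimage, Prod.fst_swap, Prod.snd_swap, isCoprime_comm (x := r)]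
    constructor
    · rintro ⟨h1, h2, h3, h4⟩
      rw [hc p m h1, hc r n h2] at h4
      rw [natDegree_le_lt] at h1 h2
      rw [degree_lt_succ]
      tauto
    · rintro (⟨h1, h2, h3⟩ | ⟨h1, h2, h3⟩)
      · have hp := (natDegree_le_lt p m).2 (Or.inr h1)
        have hr := (natDegree_le_lt r n).2 ((degree_lt_succ _ _).1 h2)
        exact ⟨hp, hr, h3, fun h => coeff_ne_zero_of_eq_degree h1 h.1⟩
      · have hp := (natDegree_le_lt p m).2 (Or.inl h2)
        have hr := (natDegree_le_lt r n).2 (Or.inr h1)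
        exact ⟨hp, hr, h3, fun h => coeff_ne_zero_of_eq_degree h1 h.2⟩
  rw [h, Set.ncard_union_eq _ (G_finite _ _) ((G_finite _ _).image _),
    Set.ncard_image_of_injective _ Prod.swap_injective, G_card _ _ hm (by omega),
    G_card _ _ hn hm]
  · obtain ⟨q, hq⟩ : ∃ q, Fintype.card F = q + 1 :=
      ⟨_, (Nat.succ_pred_eq_of_pos Fintype.card_pos).symm⟩
    obtain ⟨e, he⟩ : ∃ e, m + n = e + 1 := ⟨m + n - 1, by omega⟩
    rw [hq, show m + (n + 1) - 1 = e + 1 by omega, show n + m - 1 = e by omega,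
      show m + n - 1 = e by omega, show (q + 1) ^ 2 - 1 = q ^ 2 + 2 * q by
        rw [show (q + 1) ^ 2 = q ^ 2 + 2 * q + 1 by ring]; rfl]
    simp only [Nat.add_sub_cancel]
    ring
  · rw [Set.disjoint_left]
    rintro ⟨p, r⟩ h1 h2
    simp only [G, Set.mem_ofPred_eq, Set.image_swap_eq_preimage_swap,
      Set.mem_preimage, Prod.fst_swap, Prod.snd_swap] at h1 h2
    rw [h1.1] at h2
    exact lt_irrefl _ h2.2.1

section eval
variable {K : Type*} [Field K] [Algebra F K]

theorem aeval_ne (p : F[X]) (m : ℕ) (hp : p.natDegree ≤ m) (a b : K) (hb : b ≠ 0) :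
    MvPolynomial.aeval ![a, b] (p.homogenize m) = Polynomial.aeval (a / b) p * b ^ m := by
  have h := eval_homogenize (p := p.map (algebraMap F K)) (n := m)
    ((natDegree_map_le).trans hp) ![a, b] (by simpa using hb)
  rw [homogenize_map, MvPolynomial.eval_map, Polynomial.eval_map] at h
  exact h

theorem aeval_zero (p : F[X]) (m : ℕ) (a : K) :
    MvPolynomial.aeval ![a, 0] (p.homogenize m) = algebraMap F K (p.coeff m) * a ^ m := by
  rw [homogenize, map_sum, Finset.sum_eq_single (m, 0)]
  · simp [MvPolynomial.aeval_monomial, Finsupp.prod_fintype]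
  · rintro ⟨i, j⟩ hij hne
    rw [Finset.HasAntidiagonal.mem_antidiagonal] at hij
    have hj : j ≠ 0 := by
      rintro rfl
      apply hne
      simp at hij
      rw [hij]
    simp [MvPolynomial.aeval_monomial, Finsupp.prod_fintype, hj]
  · intro h; simp at h

theorem cond_iff [IsAlgClosed K] (p r : F[X]) (m n : ℕ) (hp : p.natDegree ≤ m)
    (hr : r.natDegree ≤ n) (hm : 1 ≤ m) (hn : 1 ≤ n) :
    (∀ a b : K, ¬(a = 0 ∧ b = 0) →
        ¬(MvPolynomial.aeval ![a, b] (p.homogenize m) = 0 ∧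
          MvPolynomial.aeval ![a, b] (r.homogenize n) = 0)) ↔
      IsCoprime p r ∧ ¬ (p.coeff m = 0 ∧ r.coeff n = 0) := by
  rw [isCoprime_iff_aeval_ne_zero_of_isAlgClosed F K p r]
  constructor
  · intro h
    constructor
    · intro a
      have := h a 1 (by simp)
      rw [aeval_ne p m hp a 1 one_ne_zero, aeval_ne r n hr a 1 one_ne_zero] at this
      simp only [div_one, one_pow, mul_one] at this
      tauto
    · have := h 1 0 (by simp)
      simpa [aeval_zero] using this
  · rintro ⟨h1, h2⟩ a b hab
    by_cases hb : b = 0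
    · subst hb
      have ha : a ≠ 0 := by tauto
      simpa [aeval_zero, ha] using h2
    · rw [aeval_ne p m hp a b hb, aeval_ne r n hr a b hb]
      have := h1 (a / b)
      simp only [mul_eq_zero, hb, pow_ne_zero, ne_eq, not_false_eq_true,
        or_false]
      tauto
end eval

theorem dehom_natDegree (f : MvPolynomial (Fin 2) F) (m : ℕ) (hf : f.IsHomogeneous m) :
    ∃ p : F[X], p.natDegree ≤ m ∧ p.homogenize m = f := by
  refine ⟨MvPolynomial.aeval ![Polynomial.X, 1] f, ?_, homogenize_eq_of_isHomogeneous hf rfl⟩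
  rw [f.as_sum, map_sum]
  apply natDegree_sum_le_of_forall_le
  intro d hd
  have hdeg : d.weight 1 = m := hf (by simpa using hd)
  have hd0 : d 0 ≤ m := by
    simp [Finsupp.weight_apply, Finsupp.sum_fintype, Fin.sum_univ_two] at hdeg
    omega
  rw [MvPolynomial.aeval_monomial, Finsupp.prod_fintype _ _ (by simp)]
  simp only [Fin.prod_univ_two, Matrix.cons_val_zero, Matrix.cons_val_one, one_pow, mul_one]
  exact (natDegree_C_mul_X_pow_le _ _).trans hd0

end CoprimeCount

theorem count_coprime_homogeneous_pairs (q : ℕ) (F K : Type*) [Field F] [Fintype F]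
    (hF : Fintype.card F = q) [Field K] [Algebra F K] [IsAlgClosure F K]
    (m n : ℕ) (hm : 1 ≤ m) (hn : 1 ≤ n) :
    Nat.card {p : MvPolynomial (Fin 2) F × MvPolynomial (Fin 2) F //
      p.1 ≠ 0 ∧ p.2 ≠ 0 ∧ p.1.IsHomogeneous m ∧ p.2.IsHomogeneous n ∧
      ∀ a b : K, ¬(a = 0 ∧ b = 0) →
        ¬(MvPolynomial.aeval ![a, b] p.1 = 0 ∧ MvPolynomial.aeval ![a, b] p.2 = 0)}
      = q ^ (m + n - 1) * (q - 1) * (q ^ 2 - 1) := by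
  have : IsAlgClosed K := IsAlgClosure.isAlgClosed F
  subst hF
  rw [← CoprimeCount.S_card m n hm hn]
  have himg : {p : MvPolynomial (Fin 2) F × MvPolynomial (Fin 2) F |
      p.1 ≠ 0 ∧ p.2 ≠ 0 ∧ p.1.IsHomogeneous m ∧ p.2.IsHomogeneous n ∧
      ∀ a b : K, ¬(a = 0 ∧ b = 0) →
        ¬(MvPolynomial.aeval ![a, b] p.1 = 0 ∧ MvPolynomial.aeval ![a, b] p.2 = 0)} =
      (fun z : Polynomial F × Polynomial F => (z.1.homogenize m, z.2.homogenize n)) ''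
        CoprimeCount.S F m n := by
    ext ⟨f, g⟩
    simp only [Set.mem_ofPred_eq, Set.mem_image, CoprimeCount.S, Prod.exists, Prod.mk.injEq]
    constructor
    · rintro ⟨-, -, hf, hg, h⟩
      obtain ⟨p, hp, rfl⟩ := CoprimeCount.dehom_natDegree f m hf
      obtain ⟨r, hr, rfl⟩ := CoprimeCount.dehom_natDegree g n hg
      rw [CoprimeCount.cond_iff p r m n hp hr hm hn] at h
      exact ⟨p, r, ⟨hp, hr, h⟩, rfl, rfl⟩
    · rintro ⟨p, r, ⟨hp, hr, h⟩, rfl, rfl⟩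
      rw [CoprimeCount.cond_iff p r m n hp hr hm hn]
      refine ⟨?_, ?_, Polynomial.isHomogeneous_homogenize p,
        Polynomial.isHomogeneous_homogenize r, h⟩
      · intro h0
        have h1 := Polynomial.eq_zero_of_homogenize_eq_zero hp h0
        subst h1
        rw [isCoprime_zero_left] at h
        apply h.2
        refine ⟨by simp, Polynomial.coeff_eq_zero_of_natDegree_lt ?_⟩
        rw [Polynomial.natDegree_eq_zero_of_isUnit h.1]; omega
      · intro h0
        have h1 := Polynomial.eq_zero_of_homogenize_eq_zero hr h0
        subst h1
        rw [isCoprime_zero_right] at h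
        apply h.2
        refine ⟨Polynomial.coeff_eq_zero_of_natDegree_lt ?_, by simp⟩
        rw [Polynomial.natDegree_eq_zero_of_isUnit h.1]; omega
  have key := congrArg Set.ncard himg
  rw [Set.ncard_image_of_injOn] at key
  · rw [← key]; rfl
  · rintro ⟨p, r⟩ ⟨hp, hr, -⟩ ⟨p', r'⟩ ⟨hp', hr', -⟩ h
    simp only [Prod.mk.injEq] at h hp hr hp' hr' ⊢
    constructor
    · rw [← Polynomial.aeval_homogenize_X_one p hp, h.1, Polynomial.aeval_homogenize_X_one p' hp']
    · rw [← Polynomial.aeval_homogenize_X_one r hr, h.2, Polynomial.aeval_homogenize_X_one r' hr']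
end

section
/- Let F be a finite field with q elements, R = F[x, y] the polynomial ring in two variables, and n a natural number. Then the set of ideals I ⊆ R such that the quotient R/I is an F-vector space of dimension n is finite, and its cardinality equals Σ_{λ ⊢ n} q^{n + ℓ(λ)}, the sum running over all partitions λ of n, where ℓ(λ) denotes the number of parts of λ. -/
namespace QuotCount

open Polynomial
variable {K : Type*} [Field K]

/-- The monic polynomials attached to the data `(a, c)`. -/
noncomputable def g (a : ℕ → K[X]) (c : ℕ → ℕ → K[X]) : ℕ → K[X][X]
  | 0 => 1
  | k + 1 => X * g a c k -
      ∑ j : Fin (k + 1), C (c k j * ∏ i ∈ Finset.Ico (j : ℕ) k, a i) * g a c j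
  decreasing_by
    · omega
    · exact j.2

/-- The generators of the leading coefficient ideals. -/
noncomputable def d (a : ℕ → K[X]) (N k : ℕ) : K[X] := ∏ i ∈ Finset.Ico k N, a i

theorem g_succ (a : ℕ → K[X]) (c : ℕ → ℕ → K[X]) (k : ℕ) :
    g a c (k + 1) = X * g a c k -
      ∑ j ∈ Finset.range (k + 1), (c k j * ∏ i ∈ Finset.Ico j k, a i) • g a c j := by
  rw [g, Finset.sum_range]
  simp only [smul_eq_C_mul]

theorem g_spec (a : ℕ → K[X]) (c : ℕ → ℕ → K[X]) (k : ℕ) :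
    (g a c k).degree = k ∧ (g a c k).Monic := by
  induction k using Nat.strong_induction_on with
  | _ k ih =>
    rcases k with _ | k
    · simp [g]
    · obtain ⟨h1, h2⟩ := ih k (by omega)
      have hX : (X * g a c k).degree = ((k + 1 : ℕ) : WithBot ℕ) := by
        rw [degree_mul, h1, degree_X, add_comm]; rfl
      have hs : (∑ j ∈ Finset.range (k + 1),
          (c k j * ∏ i ∈ Finset.Ico j k, a i) • g a c j).degree < ((k + 1 : ℕ) : WithBot ℕ) := by
        rw [← mem_degreeLT]
        refine Submodule.sum_mem _ fun j hj => Submodule.smul_mem _ _ ?_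
        rw [mem_degreeLT, (ih j (Finset.mem_range.1 hj)).1]
        exact_mod_cast Finset.mem_range.1 hj
      rw [← hX] at hs
      rw [g_succ]
      exact ⟨by rw [degree_sub_eq_left_of_degree_lt hs, hX],
        (monic_X.mul h2).sub_of_left hs⟩

/-- The `g k` as a polynomial sequence. -/
noncomputable def gseq (a : ℕ → K[X]) (c : ℕ → ℕ → K[X]) : Polynomial.Sequence K[X] where
  elems' := g a c
  degree_eq' k := (g_spec a c k).1

/-- The basis of the `g k`. -/
noncomputable def B (a : ℕ → K[X]) (c : ℕ → ℕ → K[X]) : Module.Basis ℕ K[X] K[X][X] :=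
  (gseq a c).basis fun i => by
    have : (gseq a c i).leadingCoeff = 1 := (g_spec a c i).2
    rw [this]; exact isUnit_one

theorem B_apply (a : ℕ → K[X]) (c : ℕ → ℕ → K[X]) (k : ℕ) : B a c k = g a c k :=
  Polynomial.Sequence.basis_eq_self ..

theorem repr_g (a : ℕ → K[X]) (c : ℕ → ℕ → K[X]) (k : ℕ) :
    (B a c).repr (g a c k) = Finsupp.single k 1 := by
  rw [← B_apply, Module.Basis.repr_self]

theorem degree_sub_lt' (a : ℕ → K[X]) (c : ℕ → ℕ → K[X]) (k : ℕ) (p : K[X][X])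
    (hp : p.degree < ((k + 1 : ℕ) : WithBot ℕ)) :
    (p - p.coeff k • g a c k).degree < (k : WithBot ℕ) := by
  obtain ⟨h1, h2⟩ := g_spec a c k
  rw [degree_lt_iff_coeff_zero] at hp ⊢
  intro m hm
  rcases hm.eq_or_lt with rfl | hm
  · have : (g a c k).coeff k = 1 := by
      have := h2.coeff_natDegree
      rwa [natDegree_eq_of_degree_eq_some h1] at this
    simp [this]
  · have : (g a c k).coeff m = 0 := coeff_eq_zero_of_degree_lt (by rw [h1]; exact_mod_cast hm)
    simp [this, hp m hm]

theorem repr_of_degree (a : ℕ → K[X]) (c : ℕ → ℕ → K[X]) (k : ℕ) :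
    ∀ p : K[X][X], p.degree < (k : WithBot ℕ) → ∀ j, k ≤ j → (B a c).repr p j = 0 := by
  induction k with
  | zero =>
    intro p hp j _
    have : p = 0 := by
      rw [← degree_eq_bot]
      simpa [Nat.WithBot.lt_zero_iff] using hp
    simp [this]
  | succ k ih =>
    intro p hp j hj
    have := ih _ (degree_sub_lt' a c k p hp) j (by omega)
    rw [map_sub, map_smul, repr_g] at this
    simpa [Finsupp.single_apply, show k ≠ j by omega] using this

theorem repr_coeff (a : ℕ → K[X]) (c : ℕ → ℕ → K[X]) (k : ℕ) (p : K[X][X])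
    (hp : p.degree < ((k + 1 : ℕ) : WithBot ℕ)) : (B a c).repr p k = p.coeff k := by
  have := repr_of_degree a c k _ (degree_sub_lt' a c k p hp) k le_rfl
  rw [map_sub, map_smul, repr_g] at this
  simpa [sub_eq_zero] using this

theorem d_succ (a : ℕ → K[X]) (N k : ℕ) (ha : ∀ i, N ≤ i → a i = 1) :
    d a N k = a k * d a N (k + 1) := by
  unfold d
  by_cases h : k < N
  · rw [Finset.prod_eq_prod_Ico_succ_bot h]
  · rw [Finset.Ico_eq_empty (by omega), Finset.Ico_eq_empty (by omega), ha k (by omega)]; simp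

theorem d_split (a : ℕ → K[X]) (N k j : ℕ) (hjk : j ≤ k) (ha : ∀ i, N ≤ i → a i = 1) :
    d a N j = (∏ i ∈ Finset.Ico j k, a i) * d a N k := by
  induction k, hjk using Nat.le_induction with
  | base => simp
  | succ k hk ih => rw [ih, d_succ a N k ha, Finset.prod_Ico_succ_top hk]; ring

theorem d_monic (a : ℕ → K[X]) (N k : ℕ) (ha : ∀ i, (a i).Monic) : (d a N k).Monic :=
  monic_prod_of_monic _ _ fun i _ => ha i

/-- The submodule attached to the data. -/
noncomputable def S (a : ℕ → K[X]) (c : ℕ → ℕ → K[X]) (N : ℕ) : Submodule K[X] K[X][X] :=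
  Submodule.span K[X] (Set.range fun k => d a N k • g a c k)

theorem mem_S (a : ℕ → K[X]) (c : ℕ → ℕ → K[X]) (N : ℕ) (p : K[X][X]) :
    p ∈ S a c N ↔ ∀ k, d a N k ∣ (B a c).repr p k := by
  constructor
  · intro hp
    induction hp using Submodule.span_induction with
    | mem x hx =>
      obtain ⟨j, rfl⟩ := hx
      intro k
      simp only [map_smul, repr_g]
      by_cases h : j = k
      · subst h; simp
      · simp [h]
    | zero => simp
    | add x y _ _ hx hy => intro k; simpa using dvd_add (hx k) (hy k)
    | smul r x _ hx => intro k; simpa using Dvd.dvd.mul_left (hx k) r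
  · intro h
    rw [← (B a c).linearCombination_repr p, Finsupp.linearCombination_apply]
    refine Submodule.sum_mem _ fun k _ => ?_
    obtain ⟨r, hr⟩ := h k
    simp only [hr, B_apply]
    rw [mul_comm, mul_smul]
    exact Submodule.smul_mem _ _ (Submodule.subset_span ⟨k, rfl⟩)

theorem dg_mem (a : ℕ → K[X]) (c : ℕ → ℕ → K[X]) (N k : ℕ) : d a N k • g a c k ∈ S a c N :=
  Submodule.subset_span ⟨k, rfl⟩

theorem X_mul_mem (a : ℕ → K[X]) (c : ℕ → ℕ → K[X]) (N : ℕ) (ha : ∀ i, N ≤ i → a i = 1)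
    (p : K[X][X]) (hp : p ∈ S a c N) : X * p ∈ S a c N := by
  induction hp using Submodule.span_induction with
  | mem x hx =>
    obtain ⟨k, rfl⟩ := hx
    have : X * d a N k • g a c k = a k • (d a N (k + 1) • g a c (k + 1)) +
        ∑ j ∈ Finset.range (k + 1), c k j • (d a N j • g a c j) := by
      have h2 : d a N k • ∑ j ∈ Finset.range (k + 1),
          (c k j * ∏ i ∈ Finset.Ico j k, a i) • g a c j =
          ∑ j ∈ Finset.range (k + 1), c k j • (d a N j • g a c j) := by
        rw [Finset.smul_sum]
        refine Finset.sum_congr rfl fun j hj => ?_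
        rw [d_split a N k j (by have := Finset.mem_range.1 hj; omega) ha, smul_smul, smul_smul]
        congr 1; ring
      rw [smul_smul, ← d_succ a N k ha, g_succ, smul_sub, mul_smul_comm, h2, sub_add_cancel]
    rw [this]
    exact add_mem (Submodule.smul_mem _ _ (dg_mem a c N _))
      (Submodule.sum_mem _ fun j _ => Submodule.smul_mem _ _ (dg_mem a c N _))
  | zero => simp
  | add x y _ _ hx hy => rw [mul_add]; exact add_mem hx hy
  | smul r x _ hx => rw [mul_smul_comm]; exact Submodule.smul_mem _ _ hx

/-- The ideal attached to the data. -/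
noncomputable def idl (a : ℕ → K[X]) (c : ℕ → ℕ → K[X]) (N : ℕ) (ha : ∀ i, N ≤ i → a i = 1) :
    Ideal K[X][X] where
  carrier := S a c N
  add_mem' := fun hx hy => add_mem hx hy
  zero_mem' := (S a c N).zero_mem
  smul_mem' := by
    intro q p hp
    rw [smul_eq_mul]
    induction q using Polynomial.induction_on' with
    | add x y hx hy => rw [add_mul]; exact add_mem hx hy
    | monomial n r =>
      rw [← smul_X_eq_monomial, smul_mul_assoc]
      refine Submodule.smul_mem _ _ ?_
      induction n with
      | zero => simpa using hp
      | succ n ih => rw [pow_succ', mul_assoc]; exact X_mul_mem a c N ha _ ih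

theorem mem_idl (a : ℕ → K[X]) (c : ℕ → ℕ → K[X]) (N : ℕ) (ha : ∀ i, N ≤ i → a i = 1)
    (p : K[X][X]) : p ∈ idl a c N ha ↔ ∀ k, d a N k ∣ (B a c).repr p k :=
  mem_S a c N p

theorem dg_mem_idl (a : ℕ → K[X]) (c : ℕ → ℕ → K[X]) (N k : ℕ) (ha : ∀ i, N ≤ i → a i = 1) :
    d a N k • g a c k ∈ idl a c N ha := dg_mem a c N k


theorem g_congr (a a' : ℕ → K[X]) (c c' : ℕ → ℕ → K[X]) (k : ℕ) (ha : ∀ i, a i = a' i)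
    (hc : ∀ i < k, ∀ j ≤ i, c i j = c' i j) : g a c k = g a' c' k := by
  obtain rfl : a = a' := funext ha
  induction k using Nat.strong_induction_on with
  | _ k ih =>
    rcases k with _ | k
    · simp [g]
    · rw [g_succ, g_succ, ih k (by omega) fun i hi => hc i (by omega)]
      congr 1
      refine Finset.sum_congr rfl fun j hj => ?_
      have := Finset.mem_range.1 hj
      rw [ih j this fun i hi => hc i (by omega), hc k (by omega) j (by omega)]

theorem idl_inj (a a' : ℕ → K[X]) (c c' : ℕ → ℕ → K[X]) (N : ℕ)
    (ha : ∀ i, N ≤ i → a i = 1) (ha' : ∀ i, N ≤ i → a' i = 1)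
    (hm : ∀ i, (a i).Monic) (hm' : ∀ i, (a' i).Monic)
    (hc : ∀ i j, (c i j).degree < (a i).degree) (hc' : ∀ i j, (c' i j).degree < (a' i).degree)
    (h : idl a c N ha = idl a' c' N ha') :
    (∀ i, a i = a' i) ∧ ∀ i, ∀ j ≤ i, c i j = c' i j := by
  have key : ∀ (a a' : ℕ → K[X]) (c c' : ℕ → ℕ → K[X]) (ha : ∀ i, N ≤ i → a i = 1)
      (ha' : ∀ i, N ≤ i → a' i = 1), idl a c N ha = idl a' c' N ha' →
      ∀ k, d a' N k ∣ d a N k := by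
    intro a a' c c' ha ha' h k
    have h1 := dg_mem_idl a c N k ha
    rw [h, mem_idl] at h1
    have h2 := h1 k
    obtain ⟨h3, h4⟩ := g_spec a c k
    rw [map_smul, Finsupp.smul_apply, repr_coeff a' c' k _ (by rw [h3]; exact_mod_cast k.lt_succ_self)] at h2
    have : (g a c k).coeff k = 1 := by
      have := h4.coeff_natDegree
      rwa [natDegree_eq_of_degree_eq_some h3] at this
    simpa [this] using h2
  have hd : ∀ k, d a N k = d a' N k := fun k =>
    eq_of_monic_of_associated (d_monic a N k hm) (d_monic a' N k hm')
      (associated_of_dvd_dvd (key a' a c' c ha' ha h.symm k) (key a a' c c' ha ha' h k))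
  have haa : ∀ i, a i = a' i := by
    intro i
    have h1 := d_succ a N i ha
    rw [hd i, hd (i + 1), d_succ a' N i ha'] at h1
    exact (mul_right_cancel₀ (d_monic a' N (i + 1) hm').ne_zero h1).symm
  refine ⟨haa, ?_⟩
  obtain rfl : a = a' := funext haa
  intro k
  induction k using Nat.strong_induction_on with
  | _ k ih =>
    intro j hj
    have hg : ∀ i ≤ k, g a c i = g a c' i := fun i hi =>
      g_congr a a c c' i haa fun i' hi' => ih i' (by omega)
    have h1 := dg_mem_idl a c' N (k + 1) ha'
    rw [← h] at h1
    have h2 := sub_mem h1 (dg_mem_idl a c N (k + 1) ha)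
    have h3 : d a N (k + 1) • g a c' (k + 1) - d a N (k + 1) • g a c (k + 1) =
        d a N (k + 1) • ∑ j ∈ Finset.range (k + 1),
          ((c k j - c' k j) * ∏ i ∈ Finset.Ico j k, a i) • g a c j := by
      rw [← smul_sub, g_succ, g_succ, hg k le_rfl, sub_sub_sub_cancel_left,
        ← Finset.sum_sub_distrib]
      congr 1
      refine Finset.sum_congr rfl fun j hj => ?_
      have := Finset.mem_range.1 hj
      rw [hg j (by omega), sub_mul, sub_smul]
    rw [h3, mem_idl] at h2
    have h4 := h2 j
    rw [map_smul, map_sum, Finsupp.smul_apply, Finsupp.finsetSum_apply,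
      Finset.sum_eq_single j] at h4
    · rw [map_smul, repr_g, Finsupp.smul_apply, Finsupp.single_eq_same, d_split a N k j hj ha,
        d_succ a N k ha] at h4
      simp only [smul_eq_mul, mul_one] at h4
      have hne : (∏ i ∈ Finset.Ico j k, a i) * d a N (k + 1) ≠ 0 :=
        ((monic_prod_of_monic _ _ fun i _ => hm i).mul (d_monic a N (k + 1) hm)).ne_zero
      have h5 : a k ∣ c k j - c' k j := by
        rw [← mul_dvd_mul_iff_left hne]
        convert h4 using 1 <;> ring
      have h6 := eq_zero_of_dvd_of_degree_lt h5
        (lt_of_le_of_lt (degree_sub_le _ _) (max_lt (hc k j) (hc' k j)))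
      exact sub_eq_zero.1 h6
    · intro i _ hij
      rw [map_smul, repr_g]
      simp [hij.symm]
    · intro h; exact absurd (Finset.mem_range.2 (by omega)) h

theorem repr_dvd (a : ℕ → K[X]) (c : ℕ → ℕ → K[X]) (I : Ideal K[X][X]) (δ : ℕ → K[X])
    (h1 : ∀ k, ∀ p ∈ I, p.degree < ((k + 1 : ℕ) : WithBot ℕ) → δ k ∣ p.coeff k) (k : ℕ)
    (hI : ∀ j < k, δ j • g a c j ∈ I) :
    ∀ p ∈ I, p.degree < (k : WithBot ℕ) → ∀ j, δ j ∣ (B a c).repr p j := by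
  induction k with
  | zero =>
    intro p _ hp j
    rw [repr_of_degree a c 0 p hp j (by omega)]
    exact dvd_zero _
  | succ k ih =>
    intro p hpI hp j
    obtain ⟨r, hr⟩ := h1 k p hpI hp
    have h2 : p - p.coeff k • g a c k ∈ I := by
      refine sub_mem hpI ?_
      rw [hr, mul_comm, mul_smul, smul_eq_C_mul r]
      exact I.mul_mem_left _ (hI k (by omega))
    have := ih (fun j hj => hI j (by omega)) _ h2 (degree_sub_lt' a c k p hp) j
    rw [map_sub, map_smul, repr_g, Finsupp.sub_apply, Finsupp.smul_apply] at this
    by_cases hjk : k = j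
    · subst hjk
      simp only [Finsupp.single_eq_same, smul_eq_mul, mul_one] at this
      exact (dvd_sub_left ⟨r, hr⟩).1 this
    · simpa [Finsupp.single_apply, hjk] using this

theorem expand (a : ℕ → K[X]) (c : ℕ → ℕ → K[X]) (k : ℕ) (p : K[X][X])
    (hp : p.degree < (k : WithBot ℕ)) :
    p = ∑ j ∈ Finset.range k, (B a c).repr p j • g a c j := by
  conv_lhs => rw [← (B a c).linearCombination_repr p, Finsupp.linearCombination_apply]
  rw [Finsupp.sum_of_support_subset (s := Finset.range k)]
  · simp only [B_apply]
  · intro j hj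
    rw [Finset.mem_range]
    by_contra hjk
    exact Finsupp.mem_support_iff.1 hj (repr_of_degree a c k p hp j (by omega))
  · simp

set_option maxHeartbeats 1000000 in
theorem exists_data_step (I : Ideal K[X][X]) (δ a : ℕ → K[X])
    (h1 : ∀ k, ∀ p ∈ I, p.degree < ((k + 1 : ℕ) : WithBot ℕ) → δ k ∣ p.coeff k)
    (h2 : ∀ k, ∃ p ∈ I, p.degree < ((k + 1 : ℕ) : WithBot ℕ) ∧ p.coeff k = δ k)
    (ha : ∀ k, δ k = a k * δ (k + 1)) (hm : ∀ k, (a k).Monic) (k : ℕ) :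
    ∃ c : ℕ → ℕ → K[X], (∀ i j, (c i j).degree < (a i).degree) ∧ (∀ i j, i < j → c i j = 0) ∧
      ∀ j ≤ k, δ j • g a c j ∈ I := by
  have hsplit : ∀ k j, j ≤ k → δ j = (∏ i ∈ Finset.Ico j k, a i) * δ k := by
    intro k j hjk
    induction k, hjk using Nat.le_induction with
    | base => simp
    | succ k hk ih => rw [ih, ha k, Finset.prod_Ico_succ_top hk]; ring
  induction k with
  | zero =>
    refine ⟨fun _ _ => 0, fun i j => ?_, fun _ _ _ => rfl, fun j hj => ?_⟩
    · rw [degree_zero, bot_lt_iff_ne_bot, degree_ne_bot]; exact (hm i).ne_zero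
    · obtain rfl : j = 0 := by omega
      obtain ⟨p, hp, hd, hc⟩ := h2 0
      have : p = C (p.coeff 0) := eq_C_of_degree_le_zero (by
        rw [degree_le_iff_coeff_zero]
        rw [degree_lt_iff_coeff_zero] at hd
        intro m hm
        exact hd m (Nat.succ_le_of_lt (by simpa using hm)))
      rw [hc] at this
      rw [g, smul_eq_C_mul, mul_one, ← this]
      exact hp
  | succ k ih =>
    obtain ⟨c, hc1, hc2, hc3⟩ := ih
    obtain ⟨f, hf, hfd, hfc⟩ := h2 (k + 1)
    obtain ⟨w, hw⟩ : ∃ w, w = X * (δ k • g a c k) - a k • f := ⟨_, rfl⟩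
    have hwI : w ∈ I := by
      rw [hw]
      refine sub_mem (I.mul_mem_left _ (hc3 k le_rfl)) ?_
      rw [smul_eq_C_mul]; exact I.mul_mem_left _ hf
    have hwd : w.degree < ((k + 1 : ℕ) : WithBot ℕ) := by
      obtain ⟨h3, h4⟩ := g_spec a c k
      rw [degree_lt_iff_coeff_zero] at hfd ⊢
      intro m hm
      obtain ⟨m, rfl⟩ : ∃ m', m = m' + 1 := ⟨m - 1, by omega⟩
      rw [hw, coeff_sub, coeff_X_mul, coeff_smul, coeff_smul]
      rcases hm.eq_or_lt with h | h
      · obtain rfl : k = m := by omega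
        have : (g a c k).coeff k = 1 := by
          have := h4.coeff_natDegree
          rwa [natDegree_eq_of_degree_eq_some h3] at this
        rw [this, hfc, ha k]; simp
      · rw [hfd _ (by omega), coeff_eq_zero_of_degree_lt (by rw [h3]; exact_mod_cast (by omega))]
        simp
    have hdv := repr_dvd a c I δ h1 (k + 1) (fun j hj => hc3 j (by omega)) w hwI hwd
    choose b hb using hdv
    have hwe := expand a c (k + 1) w hwd
    obtain ⟨c', hc'⟩ : ∃ c' : ℕ → ℕ → K[X],
        c' = Function.update c k fun j => if j ≤ k then b j %ₘ a k else 0 := ⟨_, rfl⟩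
    have hgc : ∀ j ≤ k, g a c' j = g a c j := fun j hj =>
      g_congr a a c' c j (fun _ => rfl) fun i hi j' _ => by
        rw [hc', Function.update_of_ne (by omega)]
    refine ⟨c', fun i j => ?_, fun i j hij => ?_, fun j hj => ?_⟩
    · by_cases hik : i = k
      · subst hik
        rw [hc', Function.update_self]
        split_ifs
        · exact degree_modByMonic_lt _ (hm i)
        · rw [degree_zero, bot_lt_iff_ne_bot, degree_ne_bot]; exact (hm i).ne_zero
      · rw [hc', Function.update_of_ne hik]; exact hc1 i j
    · by_cases hik : i = k
      · subst hik
        rw [hc', Function.update_self, if_neg (by omega)]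
      · rw [hc', Function.update_of_ne hik]; exact hc2 i j hij
    · rcases Nat.lt_or_ge j (k + 1) with hj' | hj'
      · rw [hgc j (by omega)]; exact hc3 j (by omega)
      · obtain rfl : j = k + 1 := by omega
        have e1 : δ k • g a c' (k + 1) = X * (δ k • g a c k) -
            ∑ j ∈ Finset.range (k + 1), (b j %ₘ a k) • (δ j • g a c j) := by
          rw [g_succ, smul_sub, hgc k le_rfl, mul_smul_comm, Finset.smul_sum]
          congr 1
          refine Finset.sum_congr rfl fun j hj => ?_
          have hj := Finset.mem_range.1 hj
          rw [hgc j (by omega), hc', Function.update_self, if_pos (by omega),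
            hsplit k j (by omega), smul_smul, smul_smul]
          congr 1; ring
        have e2 : w = ∑ j ∈ Finset.range (k + 1), (b j %ₘ a k) • (δ j • g a c j) +
            a k • ∑ j ∈ Finset.range (k + 1), (b j /ₘ a k) • (δ j • g a c j) := by
          conv_lhs => rw [hwe]
          rw [Finset.smul_sum, ← Finset.sum_add_distrib]
          refine Finset.sum_congr rfl fun j hj => ?_
          rw [hb j, smul_smul, smul_smul, smul_smul, ← add_smul]
          congr 1
          conv_lhs => rw [← modByMonic_add_div (b j) (a k)]
          ring
        have e3 : a k • (δ (k + 1) • g a c' (k + 1)) = a k • (f +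
            ∑ j ∈ Finset.range (k + 1), (b j /ₘ a k) • (δ j • g a c j)) := by
          rw [smul_smul, ← ha k, e1, smul_add]
          have e4 : X * (δ k • g a c k) = w + a k • f := by rw [hw, sub_add_cancel]
          rw [e4, e2]; abel
        rw [smul_right_injective _ (hm k).ne_zero e3]
        refine add_mem hf (Submodule.sum_mem _ fun j hj => ?_)
        rw [smul_eq_C_mul]
        exact I.mul_mem_left _ (hc3 j (by have := Finset.mem_range.1 hj; omega))

theorem exists_data (I : Ideal K[X][X]) (N : ℕ) (δ : ℕ → K[X]) (hδ : ∀ k, (δ k).Monic)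
    (h1 : ∀ k, ∀ p ∈ I, p.degree < ((k + 1 : ℕ) : WithBot ℕ) → δ k ∣ p.coeff k)
    (h2 : ∀ k, ∃ p ∈ I, p.degree < ((k + 1 : ℕ) : WithBot ℕ) ∧ p.coeff k = δ k)
    (hN : ∀ k, N ≤ k → δ k = 1) :
    ∃ (a : ℕ → K[X]) (c : ℕ → ℕ → K[X]) (ha : ∀ i, N ≤ i → a i = 1), (∀ i, (a i).Monic) ∧
      (∀ i j, (c i j).degree < (a i).degree) ∧ (∀ i j, i < j → c i j = 0) ∧
      idl a c N ha = I := by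
  have hdvd : ∀ k, δ (k + 1) ∣ δ k := by
    intro k
    obtain ⟨p, hp, hd, hc⟩ := h2 k
    have := h1 (k + 1) (X * p) (I.mul_mem_left _ hp) (by
      rw [degree_lt_iff_coeff_zero] at hd ⊢
      intro m hm
      obtain ⟨m, rfl⟩ : ∃ m', m = m' + 1 := ⟨m - 1, by omega⟩
      rw [coeff_X_mul]; exact hd m (by omega))
    rwa [coeff_X_mul, hc] at this
  choose a ha using hdvd
  have ha' : ∀ k, δ k = a k * δ (k + 1) := fun k => by rw [mul_comm]; exact ha k
  have hm : ∀ k, (a k).Monic := fun k => (hδ (k + 1)).of_mul_monic_left (by rw [← ha k]; exact hδ k)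
  have ha1 : ∀ i, N ≤ i → a i = 1 := fun i hi => by
    have := ha i
    rw [hN i hi, hN (i + 1) (by omega), one_mul] at this
    exact this.symm
  have hd : ∀ k, d a N k = δ k := by
    intro k
    by_cases hk : k ≤ N
    · have hsplit : ∀ k j, j ≤ k → δ j = (∏ i ∈ Finset.Ico j k, a i) * δ k := by
        intro k j hjk
        induction k, hjk using Nat.le_induction with
        | base => simp
        | succ k hk ih => rw [ih, ha' k, Finset.prod_Ico_succ_top hk]; ring
      rw [hsplit N k hk, hN N le_rfl, mul_one]; rfl
    · rw [hN k (by omega), d, Finset.Ico_eq_empty (by omega), Finset.prod_empty]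
  obtain ⟨c, hc1, hc2, hc3⟩ := exists_data_step I δ a h1 h2 ha' hm N
  have hall : ∀ j, δ j • g a c j ∈ I := by
    intro j
    by_cases hj : j ≤ N
    · exact hc3 j hj
    · induction j, (show N ≤ j by omega) using Nat.le_induction with
      | base => exact hc3 N le_rfl
      | succ j hj' ih =>
        have hj2 : δ j • g a c j ∈ I := by
          by_cases h : j ≤ N
          · exact hc3 j h
          · exact ih h
        rw [hN j hj', one_smul] at hj2
        rw [hN (j + 1) (by omega), one_smul, g_succ, Finset.sum_eq_zero, sub_zero]
        · exact I.mul_mem_left _ hj2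
        · intro i _
          have := hc1 j i
          rw [ha1 j hj', degree_one, Nat.WithBot.lt_zero_iff, degree_eq_bot] at this
          rw [this]; simp
  refine ⟨a, c, ha1, hm, hc1, hc2, le_antisymm ?_ ?_⟩
  · intro p hp
    have hp : p ∈ S a c N := hp
    induction hp using Submodule.span_induction with
    | mem x hx => obtain ⟨k, rfl⟩ := hx; simp only [hd]; exact hall k
    | zero => exact I.zero_mem
    | add x y _ _ hx hy => exact add_mem (hx ‹_›) (hy ‹_›)
    | smul r x _ hx => rw [smul_eq_C_mul]; exact I.mul_mem_left _ (hx ‹_›)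
  · intro p hp
    rw [mem_idl]
    intro k
    rw [hd]
    exact repr_dvd a c I δ h1 (p.natDegree + 1) (fun j _ => hall j) p hp
      (lt_of_le_of_lt degree_le_natDegree (by exact_mod_cast Nat.lt_succ_self _)) k


/-- The map computing the quotient by `idl`. -/
noncomputable def phi (a : ℕ → K[X]) (c : ℕ → ℕ → K[X]) (N : ℕ) :
    K[X][X] →ₗ[K[X]] ((k : Fin N) → K[X] ⧸ Ideal.span {d a N k}) :=
  LinearMap.pi fun k =>
    (Submodule.mkQ (Ideal.span {d a N k})).comp
      ((Finsupp.lapply (k : ℕ)).comp (B a c).repr.toLinearMap)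

theorem phi_apply (a : ℕ → K[X]) (c : ℕ → ℕ → K[X]) (N : ℕ) (p : K[X][X]) (k : Fin N) :
    phi a c N p k = Ideal.Quotient.mk (Ideal.span {d a N k}) ((B a c).repr p k) := rfl

theorem phi_surjective (a : ℕ → K[X]) (c : ℕ → ℕ → K[X]) (N : ℕ) :
    Function.Surjective (phi a c N) := by
  intro y
  choose z hz using fun k => Ideal.Quotient.mk_surjective (y k)
  refine ⟨∑ k : Fin N, z k • g a c k, ?_⟩
  funext k
  rw [phi_apply, ← hz k]
  congr 1
  rw [map_sum, Finsupp.finsetSum_apply, Finset.sum_eq_single k]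
  · rw [map_smul, repr_g]; simp
  · intro j _ hj
    have : (k : ℕ) ≠ j := fun h => hj (Fin.ext h.symm)
    rw [map_smul, repr_g]
    simp [this]
  · simp

theorem sum_tri (e : ℕ → ℕ) (N : ℕ) :
    ∑ k ∈ Finset.range N, ∑ i ∈ Finset.Ico k N, e i = ∑ i ∈ Finset.range N, (i + 1) * e i := by
  induction N with
  | zero => simp
  | succ N ih =>
    rw [Finset.sum_range_succ, Finset.sum_range_succ (fun i => (i + 1) * e i), ← ih]
    have : ∑ k ∈ Finset.range N, ∑ i ∈ Finset.Ico k (N + 1), e i =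
        ∑ k ∈ Finset.range N, (∑ i ∈ Finset.Ico k N, e i + e N) :=
      Finset.sum_congr rfl fun k hk => by
        rw [Finset.sum_Ico_succ_top (Finset.mem_range.1 hk).le]
    rw [this, Finset.sum_add_distrib]
    simp
    ring

theorem rank_idl (a : ℕ → K[X]) (c : ℕ → ℕ → K[X]) (N : ℕ) (ha : ∀ i, N ≤ i → a i = 1)
    (hm : ∀ i, (a i).Monic) :
    Module.rank K (K[X][X] ⧸ idl a c N ha) =
      ((∑ i ∈ Finset.range N, (i + 1) * (a i).natDegree : ℕ) : Cardinal) := by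
  have hker : (idl a c N ha).restrictScalars K = LinearMap.ker ((phi a c N).restrictScalars K) := by
    ext p
    rw [Submodule.restrictScalars_mem, mem_idl, LinearMap.mem_ker, LinearMap.restrictScalars_apply,
      funext_iff]
    simp only [phi_apply, Pi.zero_apply, Ideal.Quotient.eq_zero_iff_mem, Ideal.mem_span_singleton]
    refine ⟨fun h k => h k, fun h k => ?_⟩
    by_cases hk : k < N
    · exact h ⟨k, hk⟩
    · rw [d, Finset.Ico_eq_empty (by omega), Finset.prod_empty]; exact one_dvd _
  have e1 := Submodule.Quotient.restrictScalarsEquiv K (idl a c N ha)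
  have e2 := Submodule.quotEquivOfEq _ _ hker
  have e3 := ((phi a c N).restrictScalars K).quotKerEquivOfSurjective (phi_surjective a c N)
  have hf : ∀ k : Fin N, Module.Finite K (K[X] ⧸ Ideal.span {d a N k}) := fun k =>
    (d_monic a N k hm).finite_quotient
  rw [(e1.symm.trans (e2.trans e3)).rank_eq, ← Module.finrank_eq_rank]
  congr 1
  rw [Module.finrank_pi_fintype]
  simp only [finrank_quotient_span_eq_natDegree]
  rw [Finset.sum_fin_eq_sum_range, ← sum_tri]
  refine Finset.sum_congr rfl fun k hk => ?_
  rw [dif_pos (Finset.mem_range.1 hk), d, natDegree_prod_of_monic _ _ fun i _ => hm i]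

theorem exists_annihilator (I : Ideal K[X][X]) (n : ℕ)
    (hI : Module.rank K (K[X][X] ⧸ I) = (n : Cardinal)) (y : K[X][X]) :
    ∃ p : K[X], p.Monic ∧ p.natDegree = n ∧ aeval y p ∈ I := by
  have hfin : Module.Finite K (K[X][X] ⧸ I) := by
    rw [← Module.rank_lt_aleph0_iff, hI]; exact Cardinal.natCast_lt_aleph0
  have hfr : Module.finrank K (K[X][X] ⧸ I) = n := Module.finrank_eq_of_rank_eq hI
  set f := Algebra.lmul K (K[X][X] ⧸ I) (Ideal.Quotient.mkₐ K I y) with hf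
  refine ⟨LinearMap.charpoly f, f.charpoly_monic, by rw [f.charpoly_natDegree, hfr], ?_⟩
  have h := f.aeval_self_charpoly
  generalize f.charpoly = P at *
  rw [hf, aeval_algHom_apply, aeval_algHom_apply] at h
  have h2 := LinearMap.congr_fun h 1
  rw [← Ideal.Quotient.eq_zero_iff_mem]
  exact (mul_one _).symm.trans h2

set_option maxHeartbeats 1000000 in
theorem exists_delta (I : Ideal K[X][X]) (n : ℕ)
    (hI : Module.rank K (K[X][X] ⧸ I) = (n : Cardinal)) :
    ∃ δ : ℕ → K[X], (∀ k, (δ k).Monic) ∧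
      (∀ k, ∀ p ∈ I, p.degree < ((k + 1 : ℕ) : WithBot ℕ) → δ k ∣ p.coeff k) ∧
      (∀ k, ∃ p ∈ I, p.degree < ((k + 1 : ℕ) : WithBot ℕ) ∧ p.coeff k = δ k) ∧
      (∀ k, n ≤ k → δ k = 1) := by
  have hL : ∀ k x, x ∈ I.leadingCoeffNth k ↔
      ∃ p ∈ I, p.degree < ((k + 1 : ℕ) : WithBot ℕ) ∧ p.coeff k = x := by
    intro k x
    rw [Ideal.leadingCoeffNth, Submodule.mem_map]
    constructor
    · rintro ⟨p, ⟨hp1, hp2⟩, h⟩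
      refine ⟨p, hp2, ?_, h⟩
      exact lt_of_le_of_lt (mem_degreeLE.1 hp1) (by exact_mod_cast k.lt_succ_self)
    · rintro ⟨p, hp1, hp2, h⟩
      refine ⟨p, ⟨mem_degreeLE.2 ?_, hp1⟩, h⟩
      exact Order.le_of_lt_succ hp2
  have hne : ∀ k, I.leadingCoeffNth k ≠ ⊥ := by
    intro k hk
    obtain ⟨p, hp1, hp2, hp3⟩ := exists_annihilator I n hI (C X)
    have h0 : C p ∈ I := by
      have : aeval (C X : K[X][X]) p = C p := by
        have : (C X : K[X][X]) = (CAlgHom : K[X] →ₐ[K] K[X][X]) X := rfl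
        rw [this, aeval_algHom_apply, aeval_X_left_apply]; rfl
      rwa [this] at hp3
    have h1 := I.leadingCoeffNth_mono (Nat.zero_le k) ((I.mem_leadingCoeffNth_zero p).2 h0)
    rw [hk, Ideal.mem_bot] at h1
    exact hp1.ne_zero h1
  have hex : ∀ k, ∃ δ : K[X], δ.Monic ∧ I.leadingCoeffNth k = Ideal.span {δ} := by
    intro k
    classical
    obtain ⟨x, hx⟩ := (IsPrincipalIdealRing.principal (I.leadingCoeffNth k)).principal
    have hx0 : x ≠ 0 := by
      rintro rfl
      exact hne k (by rw [hx]; simp)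
    refine ⟨normalize x, monic_normalize hx0, ?_⟩
    rw [hx]
    exact (Ideal.span_singleton_eq_span_singleton.2 (normalize_associated x)).symm
  choose δ hδ1 hδ2 using hex
  refine ⟨δ, hδ1, ?_, ?_, ?_⟩
  · intro k p hp hd
    rw [← Ideal.mem_span_singleton, ← hδ2, hL]
    exact ⟨p, hp, hd, rfl⟩
  · intro k
    rw [← hL, hδ2]
    exact Ideal.mem_span_singleton_self _
  · intro k hk
    obtain ⟨p, hp1, hp2, hp3⟩ := exists_annihilator I n hI X
    have h0 : aeval (X : K[X][X]) p = p.map (algebraMap K K[X]) := by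
      rw [aeval_X_left_eq_map]
    rw [h0] at hp3
    have hmon := hp1.map (algebraMap K K[X])
    have h1 : (1 : K[X]) ∈ I.leadingCoeffNth n := by
      rw [Ideal.mem_leadingCoeffNth]
      refine ⟨_, hp3, ?_, hmon⟩
      rw [← hp2]
      exact le_trans degree_map_le degree_le_natDegree
    have h2 := I.leadingCoeffNth_mono hk h1
    rw [hδ2, Ideal.mem_span_singleton] at h2
    exact (hδ1 k).eq_one_of_isUnit (isUnit_of_dvd_one h2)


/-- The parameter space of the stratum attached to a partition. -/
abbrev Dt (K : Type*) [Field K] {n : ℕ} (lam : n.Partition) : Type _ :=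
  (k : Fin n) → degreeLT K (lam.parts.count ((k : ℕ) + 1)) ×
    (Fin ((k : ℕ) + 1) → degreeLT K (lam.parts.count ((k : ℕ) + 1)))

/-- The sequence `a`. -/
noncomputable def toA {n : ℕ} {lam : n.Partition} (x : Dt K lam) (k : ℕ) : K[X] :=
  if h : k < n then X ^ (lam.parts.count (k + 1)) + ((x ⟨k, h⟩).1 : K[X]) else 1

/-- The array `c`. -/
noncomputable def toC {n : ℕ} {lam : n.Partition} (x : Dt K lam) (k j : ℕ) : K[X] :=
  if h : k < n then if h' : j < k + 1 then ((x ⟨k, h⟩).2 ⟨j, h'⟩ : K[X]) else 0 else 0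

theorem toA_one {n : ℕ} {lam : n.Partition} (x : Dt K lam) (k : ℕ) (hk : n ≤ k) :
    toA x k = 1 := by rw [toA, dif_neg (by omega)]

theorem toA_monic {n : ℕ} {lam : n.Partition} (x : Dt K lam) (k : ℕ) : (toA x k).Monic := by
  rw [toA]
  split_ifs with h
  · exact monic_X_pow_add (mem_degreeLT.1 (x ⟨k, h⟩).1.2)
  · exact monic_one

theorem toA_natDegree {n : ℕ} {lam : n.Partition} (x : Dt K lam) (k : ℕ) :
    (toA x k).natDegree = lam.parts.count (k + 1) := by
  rw [toA]
  split_ifs with h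
  · exact natDegree_eq_of_degree_eq_some (by
      rw [degree_add_eq_left_of_degree_lt (by
        rw [degree_X_pow]; exact mem_degreeLT.1 (x ⟨k, h⟩).1.2), degree_X_pow])
  · rw [natDegree_one, eq_comm, Multiset.count_eq_zero]
    intro hk
    have := Nat.Partition.le_of_mem_parts hk
    omega

theorem toC_degree {n : ℕ} {lam : n.Partition} (x : Dt K lam) (k j : ℕ) :
    (toC x k j).degree < (toA x k).degree := by
  have h0 : (0 : K[X]).degree < (toA x k).degree := by
    rw [degree_zero, bot_lt_iff_ne_bot, degree_ne_bot]; exact (toA_monic x k).ne_zero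
  rw [toC]
  split_ifs with h h'
  · rw [degree_eq_natDegree (toA_monic x k).ne_zero, toA_natDegree]
    exact mem_degreeLT.1 ((x ⟨k, h⟩).2 ⟨j, h'⟩).2
  · exact h0
  · exact h0

theorem sum_count {n : ℕ} (lam : n.Partition) :
    ∑ i ∈ Finset.range n, (i + 1) * lam.parts.count (i + 1) = n := by
  have h := Finset.sum_multiset_count_of_subset lam.parts (Finset.range (n + 1)) (by
    intro i hi
    have := Nat.Partition.le_of_mem_parts (Multiset.mem_toFinset.1 hi)
    exact Finset.mem_range.2 (by omega))
  rw [lam.parts_sum, Finset.sum_range_succ'] at h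
  simp only [smul_eq_mul, mul_zero, add_zero] at h
  conv_rhs => rw [h]
  exact Finset.sum_congr rfl fun i _ => mul_comm _ _

theorem sum_count' {n : ℕ} (lam : n.Partition) :
    ∑ i ∈ Finset.range n, lam.parts.count (i + 1) = Multiset.card lam.parts := by
  rw [← Multiset.sum_count_eq_card (s := Finset.range (n + 1)) (m := lam.parts),
    Finset.sum_range_succ']
  · have : lam.parts.count 0 = 0 := Multiset.count_eq_zero.2 fun h =>
      lt_irrefl _ (lam.parts_pos h)
    rw [this, add_zero]
  · intro i hi
    have := Nat.Partition.le_of_mem_parts hi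
    exact Finset.mem_range.2 (by omega)

/-- The ideal attached to a point of a stratum. -/
noncomputable def Psi (K : Type*) [Field K] (n : ℕ) (x : Σ lam : n.Partition, Dt K lam) :
    {I : Ideal K[X][X] | Module.rank K (K[X][X] ⧸ I) = (n : Cardinal)} :=
  ⟨idl (toA x.2) (toC x.2) n (toA_one x.2), by
    rw [Set.mem_ofPred_eq, rank_idl _ _ _ _ (toA_monic x.2)]
    simp only [toA_natDegree, sum_count]⟩

theorem Psi_injective (n : ℕ) : Function.Injective (Psi K n) := by
  rintro ⟨lam, x⟩ ⟨mu, y⟩ h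
  have h := congrArg Subtype.val h
  obtain ⟨h1, h2⟩ := idl_inj _ _ _ _ n (toA_one x) (toA_one y) (toA_monic x) (toA_monic y)
    (toC_degree x) (toC_degree y) h
  have hlm : lam = mu := by
    apply Nat.Partition.ext
    rw [Multiset.ext]
    intro i
    rcases i with _ | i
    · rw [Multiset.count_eq_zero.2 fun h => lt_irrefl _ (lam.parts_pos h),
        Multiset.count_eq_zero.2 fun h => lt_irrefl _ (mu.parts_pos h)]
    · rw [← toA_natDegree x, ← toA_natDegree y, h1]
  subst hlm
  congr 1
  funext k
  refine Prod.ext (Subtype.ext ?_) (funext fun j => Subtype.ext ?_)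
  · have := h1 k
    simpa [toA] using this
  · have := h2 k j (by omega)
    rw [toC, toC, dif_pos k.2, dif_pos k.2, dif_pos j.2, dif_pos j.2] at this
    exact this

theorem idl_congr (a a' : ℕ → K[X]) (c c' : ℕ → ℕ → K[X]) (N : ℕ)
    (ha : ∀ i, N ≤ i → a i = 1) (ha' : ∀ i, N ≤ i → a' i = 1) (h : a = a') (h' : c = c') :
    idl a c N ha = idl a' c' N ha' := by
  subst h; subst h'; rfl

theorem Psi_surjective (n : ℕ) : Function.Surjective (Psi K n) := by
  rintro ⟨I, hI⟩
  obtain ⟨δ, hδ, h1, h2, h3⟩ := exists_delta I n hI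
  obtain ⟨a, c, ha, hm, hc, hc0, rfl⟩ := exists_data I n δ hδ h1 h2 h3
  have hn : ∑ i ∈ Finset.range n, (i + 1) * (a i).natDegree = n := by
    have hI : Module.rank K (K[X][X] ⧸ idl a c n ha) = (n : Cardinal) := hI
    rw [rank_idl a c n ha hm] at hI
    exact_mod_cast hI
  let lam : n.Partition :=
    { parts := ∑ k ∈ Finset.range n, Multiset.replicate (a k).natDegree (k + 1)
      parts_pos := by
        intro i hi
        rw [Multiset.mem_sum] at hi
        obtain ⟨k, _, hk⟩ := hi
        rw [Multiset.eq_of_mem_replicate hk]; omega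
      parts_sum := by
        rw [Multiset.sum_sum]
        conv_rhs => rw [← hn]
        refine Finset.sum_congr rfl fun i _ => ?_
        rw [Multiset.sum_replicate, smul_eq_mul, mul_comm] }
  have hcount : ∀ k < n, lam.parts.count (k + 1) = (a k).natDegree := by
    intro k hk
    change Multiset.count (k + 1)
      (∑ k ∈ Finset.range n, Multiset.replicate (a k).natDegree (k + 1)) = _
    rw [Multiset.count_sum', Finset.sum_eq_single k]
    · rw [Multiset.count_replicate_self]
    · intro j _ hj
      rw [Multiset.count_replicate, if_neg (by omega)]
    · intro h; exact absurd (Finset.mem_range.2 hk) h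
  let x : Dt K lam := fun k =>
    ⟨⟨a k - X ^ (lam.parts.count ((k : ℕ) + 1)), by
      rw [mem_degreeLT, hcount k k.2]
      have hd : (a k).degree = ((a k).natDegree : WithBot ℕ) :=
        degree_eq_natDegree (hm k).ne_zero
      conv_rhs => rw [← hd]
      refine degree_sub_lt_left ?_ (hm k).ne_zero ?_
      · rw [degree_X_pow, hd]
      · rw [leadingCoeff_X_pow, (hm k).leadingCoeff]⟩,
      fun j => ⟨c k j, by
        rw [mem_degreeLT, hcount k k.2, ← degree_eq_natDegree (hm k).ne_zero]
        exact hc k j⟩⟩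
  refine ⟨⟨lam, x⟩, Subtype.ext ?_⟩
  refine idl_congr _ _ _ _ n (toA_one x) ha ?_ ?_
  · funext k
    by_cases hk : k < n
    · simp [toA, hk, x]
    · rw [toA_one _ _ (by omega), ha k (by omega)]
  · funext k j
    by_cases hk : k < n
    · by_cases hj : j < k + 1
      · simp [toC, hk, hj, x]
      · simp [toC, hk, hj, hc0 k j (by omega)]
    · have := hc k j
      rw [ha k (by omega), degree_one, Nat.WithBot.lt_zero_iff, degree_eq_bot] at this
      rw [this, toC, dif_neg hk]

instance finite_degreeLT [Finite K] (m : ℕ) : Finite (degreeLT K m) :=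
  Finite.of_equiv _ (degreeLTEquiv K m).toEquiv.symm

theorem card_degreeLT [Fintype K] (m : ℕ) : Nat.card (degreeLT K m) = Fintype.card K ^ m := by
  rw [Nat.card_congr (degreeLTEquiv K m).toEquiv]
  simp

theorem card_Dt [Fintype K] {n : ℕ} (lam : n.Partition) :
    Nat.card (Dt K lam) = Fintype.card K ^ (n + Multiset.card lam.parts) := by
  rw [Nat.card_pi]
  simp only [Nat.card_prod, Nat.card_fun, card_degreeLT, Nat.card_fin, ← pow_mul, ← pow_add]
  rw [Finset.prod_pow_eq_pow_sum]
  congr 1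
  rw [← sum_count' lam]
  refine Eq.trans ?_ (congrArg (· + _) (sum_count lam))
  rw [← Finset.sum_add_distrib, Finset.sum_range]
  refine Finset.sum_congr rfl fun i _ => ?_
  ring

/-- The isomorphism of `K[x, y]` with the iterated polynomial ring. -/
noncomputable def iso (K : Type*) [Field K] : MvPolynomial (Fin 2) K ≃ₐ[K] K[X][X] :=
  (MvPolynomial.finSuccEquiv K 1).trans
    (Polynomial.mapAlgEquiv (MvPolynomial.uniqueAlgEquiv K (Fin 1)))

/-- The induced bijection of ideals of colength `n`. -/
noncomputable def idealEquiv (K : Type*) [Field K] (n : ℕ) :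
    {I : Ideal (MvPolynomial (Fin 2) K) |
        Module.rank K (MvPolynomial (Fin 2) K ⧸ I) = (n : Cardinal)} ≃
    {I : Ideal K[X][X] | Module.rank K (K[X][X] ⧸ I) = (n : Cardinal)} := by
  refine (RingEquiv.idealComapOrderIso (iso K).toRingEquiv).symm.toEquiv.subtypeEquiv ?_
  intro I
  have e := (Ideal.quotientEquivAlg I ((RingEquiv.idealComapOrderIso (iso K).toRingEquiv).symm I)
    (iso K) rfl).toLinearEquiv.rank_eq
  change Module.rank K (MvPolynomial (Fin 2) K ⧸ I) = _ ↔ Module.rank K (K[X][X] ⧸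
    ((RingEquiv.idealComapOrderIso (iso K).toRingEquiv).symm I)) = _
  rw [e]

end QuotCount

theorem count_colength_n_ideals (q : ℕ) (F : Type*) [Field F] [Fintype F]
    (hF : Fintype.card F = q) (n : ℕ) :
    {I : Ideal (MvPolynomial (Fin 2) F) |
        Module.rank F (MvPolynomial (Fin 2) F ⧸ I) = (n : Cardinal)}.Finite ∧
    Nat.card {I : Ideal (MvPolynomial (Fin 2) F) |
        Module.rank F (MvPolynomial (Fin 2) F ⧸ I) = (n : Cardinal)}
      = ∑ lam : n.Partition, q ^ (n + Multiset.card lam.parts) := by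
  let e := (Equiv.ofBijective (QuotCount.Psi F n)
    ⟨QuotCount.Psi_injective n, QuotCount.Psi_surjective n⟩).trans
      (QuotCount.idealEquiv F n).symm
  constructor
  · exact Set.finite_coe_iff.1 (Finite.of_equiv _ e)
  · rw [← Nat.card_congr e, Nat.card_sigma]
    simp only [QuotCount.card_Dt, hF]
end
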